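/- Let g : ℝ × (0,∞) → ℝ be continuous and compactly supported, with g(x₀, r) = 0 for r ≤ 1. Define ĝ(ξ, r) = ∫_ℝ g(x₀, r) e^{−i ξ x₀} dx₀ and its Hankel transform H₀ĝ(ξ, η) = ∫₀^∞ ĝ(ξ, r) J₀(η r) r dr. Define the backprojection g‡(x, z) = ∫_ℝ g(x₀, √((x−x₀)² + z²)) dx₀ for z > 0, extended evenly in z. Then for all ξ ∈ ℝ and σ ≥ 0, H₀ĝ(ξ, √(ξ² + σ²)) = 2π ĝ‡(ξ, σ), where ĝ‡ is the two-dimensional Fourier transform of g‡ restricted to the upper half plane parameterization (x,z) with z > 0 and with the lower half contributing by symmetry; explicitly H₀ĝ(ξ, √(ξ²+σ²)) = (1/(2π)) ∫_{ℝ²} [∫_ℝ g(x₀, √((x−x₀)²+z²)) dx₀] e^{−i(xξ + zσ)} dx dz. -/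

import Mathlib

open MeasureTheory Real

noncomputable def J0 (x : ℝ) : ℝ :=
  ∑' k : ℕ, (-1 : ℝ) ^ k * (x / 2) ^ (2 * k) / ((Nat.factorial k : ℝ)) ^ 2

theorem integral_sin_pow_odd_symm (k : ℕ) : ∫ θ in (-π)..π, sin θ ^ (2 * k + 1) = 0 := by
  have h := intervalIntegral.integral_comp_neg (a := -π) (b := π)
    (fun θ : ℝ => sin θ ^ (2 * k + 1))
  simp only [sin_neg, neg_neg, Odd.neg_pow (odd_two_mul_add_one k),
    intervalIntegral.integral_neg] at h
  linarith

theorem prod_odd_div_even (k : ℕ) :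
    ∏ i ∈ Finset.range k, (2 * (i : ℝ) + 1) / (2 * i + 2)
      = ((2 * k).factorial : ℝ) / (4 ^ k * (k.factorial : ℝ) ^ 2) := by
  induction k with
  | zero => simp
  | succ k ih =>
    rw [Finset.prod_range_succ, ih, show 2 * (k + 1) = 2 * k + 1 + 1 by ring]
    simp only [Nat.factorial_succ]
    have := Nat.factorial_ne_zero k
    push_cast
    field_simp
    ring

theorem integral_sin_pow_even_symm (k : ℕ) :
    ∫ θ in (-π)..π, sin θ ^ (2 * k)
      = 2 * π * (((2 * k).factorial : ℝ) / (4 ^ k * (k.factorial : ℝ) ^ 2)) := by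
  have hi (a b : ℝ) : IntervalIntegrable (fun θ : ℝ => sin θ ^ (2 * k)) volume a b :=
    Continuous.intervalIntegrable (by fun_prop) a b
  rw [← intervalIntegral.integral_add_adjacent_intervals (hi (-π) 0) (hi 0 π)]
  have h := intervalIntegral.integral_comp_neg (a := 0) (b := π)
    (fun θ : ℝ => sin θ ^ (2 * k))
  simp only [sin_neg, neg_zero, Even.neg_pow (even_two_mul k)] at h
  rw [← h, integral_sin_pow_even, prod_odd_div_even]
  ring

/-- The integral representation of `J0`. -/
theorem integral_exp_sin_eq_J0 (x : ℝ) :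
    ∫ θ in (-π)..π, Complex.exp (Complex.I * (x * sin θ : ℝ)) = 2 * π * (J0 x : ℂ) := by
  have hs : HasSum
      (fun n : ℕ => ∫ θ in (-π)..π, (Complex.I * (x * sin θ : ℝ)) ^ n / (n.factorial : ℂ))
      (∫ θ in (-π)..π, Complex.exp (Complex.I * (x * sin θ : ℝ))) := by
    refine intervalIntegral.hasSum_integral_of_dominated_convergence
      (fun n _ => |x| ^ n / (n.factorial : ℝ)) (fun n => ?_) (fun n => ?_) ?_ ?_ ?_
    · exact Continuous.aestronglyMeasurable (by fun_prop)
    · refine .of_forall fun θ _ => ?_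
      rw [norm_div, norm_pow, norm_mul, Complex.norm_I, one_mul, Complex.norm_real,
        Complex.norm_natCast, norm_eq_abs, abs_mul]
      gcongr
      exact mul_le_of_le_one_right (abs_nonneg x) (abs_sin_le_one θ)
    · exact .of_forall fun θ _ => Real.summable_pow_div_factorial |x|
    · exact intervalIntegrable_const
    · refine .of_forall fun θ _ => ?_
      rw [Complex.exp_eq_exp_ℂ]
      exact NormedSpace.expSeries_div_hasSum_exp _
  have hterm (n : ℕ) :
      ∫ θ in (-π)..π, (Complex.I * (x * sin θ : ℝ)) ^ n / (n.factorial : ℂ)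
        = (Complex.I * x) ^ n / (n.factorial : ℂ) * ((∫ θ in (-π)..π, sin θ ^ n : ℝ) : ℂ) := by
    rw [← intervalIntegral.integral_ofReal, ← intervalIntegral.integral_const_mul]
    congr 1 with θ
    push_cast
    ring
  simp only [hterm] at hs
  have hinj : Function.Injective (fun k : ℕ => 2 * k) := fun a b h => by
    simpa using h
  rw [← hinj.hasSum_iff] at hs
  · have he (k : ℕ) : (Complex.I * x) ^ (2 * k) / ((2 * k).factorial : ℂ)
          * ((∫ θ in (-π)..π, sin θ ^ (2 * k) : ℝ) : ℂ)
        = ((2 * π * ((-1 : ℝ) ^ k * (x / 2) ^ (2 * k) / ((Nat.factorial k : ℝ)) ^ 2) : ℝ) : ℂ) := by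
      have h1 : ((2 * k).factorial : ℂ) ≠ 0 := by exact_mod_cast Nat.factorial_ne_zero _
      have h2 : (k.factorial : ℂ) ≠ 0 := by exact_mod_cast Nat.factorial_ne_zero _
      rw [integral_sin_pow_even_symm, mul_pow, pow_mul Complex.I, Complex.I_sq, div_pow,
        pow_mul (2 : ℝ)]
      push_cast
      norm_num
      field_simp
    simp only [Function.comp_def, he] at hs
    rw [← hs.tsum_eq, ← Complex.ofReal_tsum, tsum_mul_left, J0]
    push_cast
    rfl
  · intro n hn
    obtain ⟨k, rfl | rfl⟩ := n.even_or_odd'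
    · exact absurd ⟨k, rfl⟩ hn
    · rw [integral_sin_pow_odd_symm]
      simp

theorem continuous_J0 : Continuous J0 := by
  have h : Continuous fun x : ℝ =>
      ∫ θ in (-π)..π, Complex.exp (Complex.I * (x * sin θ : ℝ)) :=
    intervalIntegral.continuous_parametric_intervalIntegral_of_continuous' (by fun_prop) _ _
  have h' : J0 = fun x : ℝ =>
      ((∫ θ in (-π)..π, Complex.exp (Complex.I * (x * sin θ : ℝ))) / (2 * π)).re := by
    ext x
    rw [integral_exp_sin_eq_J0, mul_div_cancel_left₀ _ (by simp), Complex.ofReal_re]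
  rw [h']
  fun_prop

/-- The angular average of a plane wave with frequency `(a, b)` over the circle of radius `r`. -/
theorem integral_planeWave_circle (a b r : ℝ) :
    ∫ θ in Set.Ioo (-π) π,
        Complex.exp (-Complex.I * ((r * cos θ : ℝ) * a + (r * sin θ : ℝ) * b))
      = 2 * π * (J0 (√(a ^ 2 + b ^ 2) * r) : ℂ) := by
  set w : ℂ := a + b * Complex.I with hw
  have hn : ‖w‖ = √(a ^ 2 + b ^ 2) := Complex.norm_add_mul_I a b
  have ha : ‖w‖ * cos w.arg = a := by simp [Complex.norm_mul_cos_arg, hw]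
  have hb : ‖w‖ * sin w.arg = b := by simp [Complex.norm_mul_sin_arg, hw]
  rw [← hn, ← integral_exp_sin_eq_J0, ← integral_Ioc_eq_integral_Ioo,
    ← intervalIntegral.integral_of_le (by linarith [pi_pos])]
  set f : ℝ → ℂ := fun θ => Complex.exp (Complex.I * (‖w‖ * r * sin θ : ℝ)) with hf
  have hper : Function.Periodic f (2 * π) := fun θ => by simp only [hf, sin_add_two_pi]
  have hshift (θ : ℝ) :
      Complex.exp (-Complex.I * ((r * cos θ : ℝ) * a + (r * sin θ : ℝ) * b))
        = f (θ - (w.arg + π / 2)) := by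
    simp only [hf]
    rw [← sub_sub, sin_sub_pi_div_two, cos_sub]
    congr 1
    rw [neg_mul, ← mul_neg]
    congr 1
    rw [← Complex.ofReal_mul, ← Complex.ofReal_mul, ← Complex.ofReal_add, ← Complex.ofReal_neg]
    congr 1
    linear_combination (r * cos θ) * ha + (r * sin θ) * hb
  simp only [hshift]
  rw [intervalIntegral.integral_comp_sub_right f]
  have h := hper.intervalIntegral_add_eq (-π - (w.arg + π / 2)) (-π)
  rw [show -π - (w.arg + π / 2) + 2 * π = π - (w.arg + π / 2) by ring,
    show -π + 2 * π = π by ring] at h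
  exact h

/-- The Fourier transform of a radial function on the plane is a Hankel transform. -/
theorem integral_radial_mul_planeWave (f : ℝ → ℂ) (hf : Continuous f)
    (hfc : HasCompactSupport f) (a b : ℝ) :
    ∫ p : ℝ × ℝ, f (√(p.1 ^ 2 + p.2 ^ 2)) * Complex.exp (-Complex.I * (p.1 * a + p.2 * b))
      = 2 * π * ∫ r in Set.Ioi (0 : ℝ), f r * (J0 (√(a ^ 2 + b ^ 2) * r) : ℂ) * (r : ℂ) := by
  let F : ℝ × ℝ → ℂ := fun q =>
    Complex.exp (-Complex.I * ((q.1 * cos q.2 : ℝ) * a + (q.1 * sin q.2 : ℝ) * b))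
      * (((q.1 : ℂ) * f q.1) * 1)
  have hF : ∀ q ∈ polarCoord.target,
      q.1 • (f (√((polarCoord.symm q).1 ^ 2 + (polarCoord.symm q).2 ^ 2))
        * Complex.exp (-Complex.I * ((polarCoord.symm q).1 * a + (polarCoord.symm q).2 * b)))
      = F q := by
    intro q hq
    have hq1 : 0 < q.1 := by
      rw [polarCoord_target] at hq
      exact hq.1
    have hr : √((q.1 * cos q.2) ^ 2 + (q.1 * sin q.2) ^ 2) = q.1 := by
      rw [show (q.1 * cos q.2) ^ 2 + (q.1 * sin q.2) ^ 2 = q.1 ^ 2 by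
        linear_combination q.1 ^ 2 * sin_sq_add_cos_sq q.2, sqrt_sq hq1.le]
    simp only [polarCoord_symm_apply, hr, F, Complex.real_smul]
    ring
  have hmeas : MeasurableSet polarCoord.target := polarCoord.open_target.measurableSet
  rw [← integral_comp_polarCoord_symm, setIntegral_congr_fun hmeas hF, polarCoord_target,
    Measure.volume_eq_prod, setIntegral_prod, ← integral_const_mul]
  · refine integral_congr_ae (.of_forall fun r => ?_)
    simp only [F]
    rw [integral_mul_const, integral_planeWave_circle]
    ring
  · rw [IntegrableOn, ← Measure.prod_restrict]
    refine Integrable.bdd_mul (c := 1) ?_ (Continuous.aestronglyMeasurable (by fun_prop))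
      (.of_forall fun q => ?_)
    · refine Integrable.mul_prod (f := fun r : ℝ => (r : ℂ) * f r) (g := fun _ : ℝ => (1 : ℂ))
        ?_ ?_
      · exact (Continuous.integrable_of_hasCompactSupport (by fun_prop)
          hfc.mul_left).integrableOn
      · exact integrableOn_const (by simp)
    · rw [show -Complex.I * ((q.1 * cos q.2 : ℝ) * a + (q.1 * sin q.2 : ℝ) * b)
        = ((-(q.1 * cos q.2 * a + q.1 * sin q.2 * b) : ℝ) : ℂ) * Complex.I by push_cast; ring,
        Complex.norm_exp_ofReal_mul_I]

theorem exists_radius_of_hasCompactSupport {g : ℝ × ℝ → ℝ} (hgc : HasCompactSupport g) :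
    ∃ R : ℝ, ∀ x r : ℝ, g (x, r) ≠ 0 → |x| ≤ R ∧ |r| ≤ R := by
  obtain ⟨R, hR⟩ := hgc.isCompact.isBounded.exists_norm_le
  refine ⟨R, fun x r h => ?_⟩
  have := hR (x, r) (subset_tsupport g h)
  rwa [Prod.norm_def, sup_le_iff] at this

theorem hankel_of_fourier_is_fourier_of_backprojection
    (g : ℝ × ℝ → ℝ) (hg : Continuous g) (hgc : HasCompactSupport g)
    (hgvan : ∀ x₀ r : ℝ, r ≤ 1 → g (x₀, r) = 0) :
    ∀ (ξ σ : ℝ), 0 ≤ σ →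
      (∫ r in Set.Ioi (0 : ℝ),
          (∫ x₀ : ℝ, (g (x₀, r) : ℂ) * Complex.exp (-Complex.I * ξ * x₀))
            * (J0 (Real.sqrt (ξ ^ 2 + σ ^ 2) * r) : ℂ) * (r : ℂ))
        = (1 / (2 * π)) *
            ∫ p : ℝ × ℝ,
              ((∫ x₀ : ℝ, g (x₀, Real.sqrt ((p.1 - x₀) ^ 2 + p.2 ^ 2))) : ℂ)
                * Complex.exp (-Complex.I * (p.1 * ξ + p.2 * σ)) := by
  intro ξ σ _
  obtain ⟨R, hR⟩ := exists_radius_of_hasCompactSupport hgc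
  have hslice (x₀ : ℝ) : HasCompactSupport fun r : ℝ => (g (x₀, r) : ℂ) := by
    refine .intro (isCompact_Icc (a := -R) (b := R)) fun r hr => ?_
    by_contra h
    exact hr (abs_le.1 (hR x₀ r (by exact_mod_cast h)).2)
  let H : ℝ × ℝ → ℝ → ℂ := fun p x₀ =>
    (g (x₀, √((p.1 - x₀) ^ 2 + p.2 ^ 2)) : ℂ) * Complex.exp (-Complex.I * (p.1 * ξ + p.2 * σ))
  have hH : Integrable (Function.uncurry H) (volume.prod volume) := by
    refine Continuous.integrable_of_hasCompactSupport (by fun_prop) ?_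
    refine .intro (K := (Set.Icc (-(2 * R)) (2 * R) ×ˢ Set.Icc (-R) R) ×ˢ Set.Icc (-R) R)
      ((isCompact_Icc.prod isCompact_Icc).prod isCompact_Icc) ?_
    rintro ⟨⟨x, z⟩, x₀⟩ hq
    by_contra h
    have hg0 : g (x₀, √((x - x₀) ^ 2 + z ^ 2)) ≠ 0 := by
      intro h0
      exact h (by simp [Function.uncurry, H, h0])
    obtain ⟨h1, h2⟩ := hR _ _ hg0
    rw [abs_of_nonneg (sqrt_nonneg _)] at h2
    have h3 : |x - x₀| ≤ R :=
      (abs_le_sqrt (by nlinarith [sq_nonneg z])).trans h2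
    have h4 : |z| ≤ R := (abs_le_sqrt (by nlinarith [sq_nonneg (x - x₀)])).trans h2
    rw [abs_le] at h1 h3 h4
    exact hq ⟨⟨⟨by dsimp only; linarith, by dsimp only; linarith⟩, h4⟩, h1⟩
  have hinner (x₀ : ℝ) : ∫ p : ℝ × ℝ, H p x₀
      = 2 * π * ∫ r in Set.Ioi (0 : ℝ), (g (x₀, r) : ℂ) * Complex.exp (-Complex.I * ξ * x₀)
          * (J0 (√(ξ ^ 2 + σ ^ 2) * r) : ℂ) * (r : ℂ) := by
    rw [← integral_add_right_eq_self (fun p => H p x₀) (x₀, (0 : ℝ))]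
    have h (p : ℝ × ℝ) : H (p + (x₀, (0 : ℝ))) x₀
        = (fun r : ℝ => (g (x₀, r) : ℂ) * Complex.exp (-Complex.I * ξ * x₀))
            (√(p.1 ^ 2 + p.2 ^ 2)) * Complex.exp (-Complex.I * (p.1 * ξ + p.2 * σ)) := by
      simp only [H, Prod.fst_add, Prod.snd_add, add_sub_cancel_right, add_zero]
      rw [mul_assoc, ← Complex.exp_add]
      congr 2
      push_cast
      ring
    simp only [h]
    exact integral_radial_mul_planeWave
      (fun r : ℝ => (g (x₀, r) : ℂ) * Complex.exp (-Complex.I * ξ * x₀)) (by fun_prop)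
      (hslice x₀).mul_right ξ σ
  have hJ : Continuous J0 := continuous_J0
  have hK : Integrable (Function.uncurry fun x₀ r : ℝ =>
      (g (x₀, r) : ℂ) * Complex.exp (-Complex.I * ξ * x₀)
        * (J0 (√(ξ ^ 2 + σ ^ 2) * r) : ℂ) * (r : ℂ)) (volume.prod volume) := by
    refine Continuous.integrable_of_hasCompactSupport (by fun_prop) ?_
    exact (((hgc.comp_left (g := fun t : ℝ => (t : ℂ)) (by simp)).mul_right).mul_right).mul_right
  have hRHS : ∫ p : ℝ × ℝ,
      (∫ x₀ : ℝ, (g (x₀, √((p.1 - x₀) ^ 2 + p.2 ^ 2)) : ℂ))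
        * Complex.exp (-Complex.I * (p.1 * ξ + p.2 * σ)) = ∫ p : ℝ × ℝ, ∫ x₀ : ℝ, H p x₀ := by
    simp only [H, integral_mul_const]
  rw [hRHS, integral_integral_swap hH]
  simp only [hinner]
  rw [integral_const_mul, integral_integral_swap, ← mul_assoc,
    one_div_mul_cancel (by simp), one_mul]
  · simp only [integral_mul_const]
  · have := hK.restrict (s := Set.univ ×ˢ Set.Ioi (0 : ℝ))
    rwa [← Measure.prod_restrict, Measure.restrict_univ] at this
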